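/- Let p1,...,p6 be natural numbers. Every induced r-cycle in Ḡ(p) with r ≥ 4 has r = 4, and its four vertices consist of exactly one vertex a_i, one vertex b_j, one vertex c_l, and one vertex d_m (one of each letter). -/

import Mathlib

/-- The four letters labeling vertices. -/
inductive Letter : Type
  | a | b | c | d
deriving DecidableEq

/-- Whether a labeled vertex is in range for the exponent vector `(p1,…,p6)`. -/
def inRange (p1 p2 p3 p4 p5 p6 : ℕ) : Letter × ℕ → Prop
  | (Letter.a, i) => 1 ≤ i ∧ i ≤ max p1 (max p2 p3)
  | (Letter.b, j) => 1 ≤ j ∧ j ≤ max p1 (max p4 p5)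
  | (Letter.c, l) => 1 ≤ l ∧ l ≤ max p2 (max p4 p6)
  | (Letter.d, m) => 1 ≤ m ∧ m ≤ max p3 (max p5 p6)

/-- The vertex set of the graph `G(p)`. -/
def Vertex (p1 p2 p3 p4 p5 p6 : ℕ) : Type :=
  {v : Letter × ℕ // inRange p1 p2 p3 p4 p5 p6 v}

/-- Directed adjacency (one orientation of each cross-letter edge rule). -/
def dirAdj (p1 p2 p3 p4 p5 p6 : ℕ) : Letter × ℕ → Letter × ℕ → Prop
  | (Letter.a, i), (Letter.b, j) => i + j ≤ p1 + 1
  | (Letter.a, i), (Letter.c, l) => i + l ≤ p2 + 1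
  | (Letter.a, i), (Letter.d, m) => i + m ≤ p3 + 1
  | (Letter.b, j), (Letter.c, l) => j + l ≤ p4 + 1
  | (Letter.b, j), (Letter.d, m) => j + m ≤ p5 + 1
  | (Letter.c, l), (Letter.d, m) => l + m ≤ p6 + 1
  | _, _ => False

/-- The graph `G(p)` whose edge ideal is the Alexander dual of the polarization. -/
def tetraGraph (p1 p2 p3 p4 p5 p6 : ℕ) : SimpleGraph (Vertex p1 p2 p3 p4 p5 p6) where
  Adj u v := dirAdj p1 p2 p3 p4 p5 p6 u.val v.val ∨ dirAdj p1 p2 p3 p4 p5 p6 v.val u.val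
  symm := ⟨fun u v h => h.symm⟩
  loopless := by
    constructor
    rintro ⟨⟨L, i⟩, _⟩ h
    cases L <;> simp [dirAdj] at h

/-- An induced `r`-cycle in a graph: `r` distinct vertices, adjacent exactly when
cyclically consecutive. -/
def IsInducedCycle {V : Type*} (H : SimpleGraph V) (r : ℕ) (v : Fin r → V) : Prop :=
  Function.Injective v ∧
    ∀ s t : Fin r, H.Adj (v s) (v t) ↔ ((s.val + 1) % r = t.val ∨ (t.val + 1) % r = s.val)

/-- The cyclic successor relation on `Fin r`, with the remainder eliminated. -/
lemma succ_mod_eq_iff {r : ℕ} (s t : Fin r) :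
    (s.val + 1) % r = t.val ↔ s.val + 1 = t.val ∨ (s.val + 1 = r ∧ t.val = 0) := by
  rcases Nat.lt_or_ge (s.val + 1) r with h | h
  · rw [Nat.mod_eq_of_lt h]
    omega
  · have hs : s.val + 1 = r := by omega
    rw [hs, Nat.mod_self]
    omega

/-- In an induced cycle of length at least four, for adjacent vertices `v s`, `v t`, the vertex
`v s` has a neighbour distinct from `v t` and not adjacent to it. -/
lemma IsInducedCycle.exists_private_neighbor {V : Type*} {H : SimpleGraph V} {r : ℕ}
    {v : Fin r → V} (hv : IsInducedCycle H r v) (hr : 4 ≤ r) {s t : Fin r}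
    (hst : H.Adj (v s) (v t)) :
    ∃ w, v w ≠ v t ∧ H.Adj (v s) (v w) ∧ ¬ H.Adj (v t) (v w) := by
  simp only [hv.1.ne_iff, hv.2, succ_mod_eq_iff, ne_eq, Fin.ext_iff] at hst ⊢
  have hs := s.isLt
  have ht := t.isLt
  by_cases h : s.val + 1 = t.val ∨ (s.val + 1 = r ∧ t.val = 0)
  · by_cases h0 : s.val = 0
    · refine ⟨⟨r - 1, by omega⟩, ?_⟩
      dsimp only
      omega
    · refine ⟨⟨s.val - 1, by omega⟩, ?_⟩
      dsimp only
      omega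
  · by_cases h0 : s.val + 1 = r
    · refine ⟨⟨0, by omega⟩, ?_⟩
      dsimp only
      omega
    · refine ⟨⟨s.val + 1, by omega⟩, ?_⟩
      dsimp only
      omega

section tetraGraph

variable {p1 p2 p3 p4 p5 p6 : ℕ} {x y z : Vertex p1 p2 p3 p4 p5 p6}

/-- Vertices with the same letter are not adjacent. -/
lemma tetraGraph_not_adj_of_letter_eq (h : x.val.1 = y.val.1) :
    ¬ (tetraGraph p1 p2 p3 p4 p5 p6).Adj x y := by
  obtain ⟨⟨L, i⟩, _⟩ := x
  obtain ⟨⟨M, j⟩, _⟩ := y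
  dsimp only at h
  subst h
  cases L <;> simp [tetraGraph, dirAdj]

/-- Among vertices with the same letter, a smaller index has a larger neighbourhood. -/
lemma tetraGraph_adj_of_index_le (hL : x.val.1 = y.val.1) (hle : x.val.2 ≤ y.val.2)
    (h : (tetraGraph p1 p2 p3 p4 p5 p6).Adj y z) :
    (tetraGraph p1 p2 p3 p4 p5 p6).Adj x z := by
  obtain ⟨⟨L, i⟩, _⟩ := x
  obtain ⟨⟨M, j⟩, _⟩ := y
  obtain ⟨⟨N, k⟩, _⟩ := z
  dsimp only at hL hle
  subst hL
  cases L <;> cases N <;> simp [tetraGraph, dirAdj] at h ⊢ <;> omega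

end tetraGraph

/-- The vertices of an induced cycle of length at least four in the complement of `G(p)` have
pairwise distinct letters. -/
lemma IsInducedCycle.letter_injective {p1 p2 p3 p4 p5 p6 r : ℕ} (hr : 4 ≤ r)
    {v : Fin r → Vertex p1 p2 p3 p4 p5 p6}
    (hv : IsInducedCycle (tetraGraph p1 p2 p3 p4 p5 p6)ᶜ r v) :
    Function.Injective fun s => (v s).val.1 := by
  intro s t hL
  by_contra hne
  wlog hle : (v s).val.2 ≤ (v t).val.2 generalizing s t
  · exact this hL.symm (Ne.symm hne) (le_of_not_ge hle)
  have hst : (tetraGraph p1 p2 p3 p4 p5 p6)ᶜ.Adj (v s) (v t) :=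
    (SimpleGraph.compl_adj _ _ _).2 ⟨hv.1.ne hne, tetraGraph_not_adj_of_letter_eq hL⟩
  obtain ⟨w, hwt, hsw, htw⟩ := hv.exists_private_neighbor hr hst
  rw [SimpleGraph.compl_adj] at hsw htw
  exact htw ⟨hwt.symm, fun h => hsw.2 (tetraGraph_adj_of_index_le hL hle h)⟩

/-- There are four letters. -/
instance : Fintype Letter where
  elems := {Letter.a, Letter.b, Letter.c, Letter.d}
  complete := by rintro (_ | _ | _ | _) <;> decide

/-- Lemma 3.3: every induced `r`-cycle (`r ≥ 4`) in the complement `Ḡ(p)` has `r = 4`,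
and its four vertices consist of exactly one vertex of each letter. -/
theorem induced_cycle_is_four_cycle_one_of_each_letter
    (p1 p2 p3 p4 p5 p6 : ℕ) (r : ℕ) (hr : 4 ≤ r)
    (v : Fin r → Vertex p1 p2 p3 p4 p5 p6)
    (hv : IsInducedCycle (tetraGraph p1 p2 p3 p4 p5 p6)ᶜ r v) :
    r = 4 ∧ ∀ L : Letter, ∃! s : Fin r, (v s).val.1 = L := by
  have hinj := hv.letter_injective hr
  have hcard : Fintype.card Letter = 4 := rfl
  have hr4 : r = 4 := by
    have := Fintype.card_le_of_injective _ hinj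
    rw [Fintype.card_fin, hcard] at this
    omega
  have hbij := (Fintype.bijective_iff_injective_and_card _).2
    ⟨hinj, by rw [Fintype.card_fin, hcard, hr4]⟩
  exact ⟨hr4, hbij.existsUnique⟩
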